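/- arXiv:1612.06003 — 2 statements merged into one kernel-verified Lean document; each statement's English description precedes it below -/
import Mathlib

section
/- (One-step descent of inexact proximal gradient, convex h.) Let h : ℝ^N → ℝ be convex, let g : ℝ^N → ℝ be differentiable with L-Lipschitz continuous gradient, let f = g + h, let γ > 0, let ε ≥ 0, and let x, x₊ ∈ ℝ^N with x₊ ∈ Prox^ε_{γh}(x − γ∇g(x)). Then f(x₊) ≤ f(x) − (1/γ − L/2)·‖x₊ − x‖² + √(2ε/γ)·‖x₊ − x‖ + ε. -/
open scoped RealInnerProductSpace
open Filter Topology

noncomputable section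

abbrev E (N : ℕ) := EuclideanSpace ℝ (Fin N)

/-- `z` is an `ε`-inexact proximal point of `h` with stepsize `γ` at `y`:
`(1/(2γ))‖z − y‖² + h(z) ≤ ε + (1/(2γ))‖x − y‖² + h(x)` for all `x`. -/
def IsInexactProx {N : ℕ} (γ : ℝ) (h : E N → ℝ) (ε : ℝ) (y z : E N) : Prop :=
  ∀ x : E N, 1 / (2 * γ) * ‖z - y‖ ^ 2 + h z ≤ ε + 1 / (2 * γ) * ‖x - y‖ ^ 2 + h x

/-- The `ε`-approximate subdifferential of `h` at `x`. -/
def epsSubdiff {N : ℕ} (h : E N → ℝ) (ε : ℝ) (x : E N) : Set (E N) :=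
  {d : E N | ∀ y : E N, h y ≥ h x + ⟪d, y - x⟫ - ε}


/-- The descent lemma: a quadratic upper bound for functions with Lipschitz gradient. -/
theorem le_quadratic_of_lipschitz_gradient {F : Type*} [NormedAddCommGroup F]
    [InnerProductSpace ℝ F] [CompleteSpace F] {g : F → ℝ} {g' : F → F} {L : ℝ}
    (hg : ∀ x, HasGradientAt g (g' x) x)
    (hlip : ∀ x y, ‖g' x - g' y‖ ≤ L * ‖x - y‖) (x y : F) :
    g y ≤ g x + ⟪g' x, y - x⟫ + L / 2 * ‖y - x‖ ^ 2 := by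
  set v := y - x with hv
  have hderiv : ∀ t : ℝ, HasDerivAt
      (fun t : ℝ => g (x + t • v) - t * ⟪g' x, v⟫ - L / 2 * ‖v‖ ^ 2 * t ^ 2)
      (⟪g' (x + t • v), v⟫ - ⟪g' x, v⟫ - L * ‖v‖ ^ 2 * t) t := by
    intro t
    have hline : HasDerivAt (fun t : ℝ => x + t • v) v t := by
      simpa using ((hasDerivAt_id t).smul_const v).const_add x
    have hcomp : HasDerivAt (fun t : ℝ => g (x + t • v)) ⟪g' (x + t • v), v⟫ t := by
      have hc := (hg (x + t • v)).hasFDerivAt.comp_hasDerivAt t hline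
      rwa [InnerProductSpace.toDual_apply_apply] at hc
    have hlin := (hasDerivAt_id t).mul_const ⟪g' x, v⟫
    have hquad := (hasDerivAt_pow 2 t).const_mul (L / 2 * ‖v‖ ^ 2)
    refine ((hcomp.sub hlin).sub hquad).congr_deriv ?_
    push_cast
    ring
  have hanti := antitoneOn_of_hasDerivWithinAt_nonpos (convex_Icc (0 : ℝ) 1)
    (fun t _ => (hderiv t).continuousAt.continuousWithinAt)
    (fun t _ => (hderiv t).hasDerivWithinAt) (fun t ht => by
      rw [interior_Icc] at ht
      have hbound : ‖g' (x + t • v) - g' x‖ ≤ L * (t * ‖v‖) := by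
        simpa [norm_smul, abs_of_pos ht.1] using hlip (x + t • v) x
      have hinner := real_inner_le_norm (g' (x + t • v) - g' x) v
      rw [inner_sub_left] at hinner
      nlinarith [mul_le_mul_of_nonneg_right hbound (norm_nonneg v)])
  have hle := hanti (Set.left_mem_Icc.2 zero_le_one) (Set.right_mem_Icc.2 zero_le_one) zero_le_one
  simp only [one_smul, zero_smul, add_zero, hv, add_sub_cancel] at hle
  linarith

/-- Testing the inexact proximal inequality along the segment from the proximal point to `x`. -/
theorem IsInexactProx.segment_le {N : ℕ} {γ ε : ℝ} {h : E N → ℝ} {G x z : E N}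
    (hstep : IsInexactProx γ h ε (x - γ • G) z) (hconv : ConvexOn ℝ Set.univ h)
    (hγ : 0 < γ) {t : ℝ} (ht0 : 0 < t) (ht1 : t ≤ 1) :
    h z - h x + ⟪G, z - x⟫ + 1 / γ * ‖z - x‖ ^ 2 ≤
      ε / t + t * ‖z - x‖ ^ 2 / (2 * γ) := by
  have hprox := hstep (z + t • (x - z))
  have hc := hconv.2 (Set.mem_univ z) (Set.mem_univ x) (sub_nonneg.2 ht1) ht0.le
    (sub_add_cancel 1 t)
  rw [show (1 - t) • z + t • x = z + t • (x - z) by module] at hc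
  rw [show z - (x - γ • G) = (z - x) + γ • G by abel,
    show z + t • (x - z) - (x - γ • G) = (1 - t) • (z - x) + γ • G by module,
    norm_add_sq_real, norm_add_sq_real, norm_smul, norm_smul, real_inner_smul_left,
    real_inner_smul_right, real_inner_comm, mul_pow _ ‖z - x‖,
    Real.norm_eq_abs (1 - t), sq_abs] at hprox
  simp only [smul_eq_mul] at hc
  have key : t * (h z - h x + ⟪G, z - x⟫ + 1 / γ * ‖z - x‖ ^ 2) ≤
      ε + t ^ 2 * ‖z - x‖ ^ 2 / (2 * γ) := by
    have hsum := add_le_add hprox hc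
    rw [← sub_nonneg] at hsum ⊢
    refine hsum.trans_eq ?_
    field_simp
    ring
  rw [← mul_le_mul_iff_right₀ ht0]
  refine key.trans_eq ?_
  field_simp

/-- Optimising the bound `ε / t + t D² / (2γ)` over `t ∈ (0, 1]`. -/
theorem le_sqrt_mul_add_of_forall_le {A D γ ε : ℝ} (hγ : 0 < γ) (hε : 0 ≤ ε) (hD : 0 ≤ D)
    (hA : ∀ t : ℝ, 0 < t → t ≤ 1 → A ≤ ε / t + t * D ^ 2 / (2 * γ)) :
    A ≤ Real.sqrt (2 * ε / γ) * D + ε := by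
  set s := Real.sqrt (2 * ε / γ) with hs
  have hs0 : 0 ≤ s := Real.sqrt_nonneg _
  have hsε : ε = γ * s ^ 2 / 2 := by
    rw [hs, Real.sq_sqrt (by positivity)]
    field_simp
  rcases le_or_gt D (γ * s) with hle | hlt
  · have h1 := hA 1 one_pos le_rfl
    have h2 : D ^ 2 / (2 * γ) ≤ s * D := by
      rw [div_le_iff₀ (by positivity)]
      nlinarith [mul_nonneg (mul_nonneg hγ.le hs0) hD, mul_le_mul_of_nonneg_right hle hD]
    rw [div_one, one_mul] at h1
    linarith
  have hDpos : 0 < D := (mul_nonneg hγ.le hs0).trans_lt hlt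
  rcases hs0.eq_or_lt with hzero | hpos
  · have hε0 : ε = 0 := by rw [hsε, ← hzero]; ring
    rw [← hzero, hε0, zero_mul, zero_add]
    by_contra! hApos
    have h1 := hA (min 1 (γ * A / D ^ 2)) (lt_min one_pos (by positivity)) (min_le_left _ _)
    have h2 : min 1 (γ * A / D ^ 2) * D ^ 2 ≤ γ * A :=
      (le_div_iff₀ (by positivity)).1 (min_le_right _ _)
    rw [hε0, zero_div, zero_add, le_div_iff₀ (by positivity)] at h1
    nlinarith [mul_pos hγ hApos]
  · have h1 := hA (γ * s / D) (by positivity) ((div_le_one hDpos).2 hlt.le)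
    have h2 : ε / (γ * s / D) + γ * s / D * D ^ 2 / (2 * γ) = s * D := by
      rw [hsε]
      field_simp
      ring
    linarith

/-- one-step descent of the inexact proximal gradient step, convex `h`. -/
theorem ipg_one_step_descent_convex_h {N : ℕ} (g h : E N → ℝ) (g' : E N → E N)
    (L γ ε : ℝ) (hL : 0 < L)
    (hg : ∀ x, HasGradientAt g (g' x) x)
    (hlip : ∀ x y, ‖g' x - g' y‖ ≤ L * ‖x - y‖)
    (hconv : ConvexOn ℝ Set.univ h)
    (hγ0 : 0 < γ) (hε : 0 ≤ ε)
    (x xp : E N)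
    (hstep : IsInexactProx γ h ε (x - γ • g' x) xp) :
    g xp + h xp ≤ g x + h x - (1 / γ - L / 2) * ‖xp - x‖ ^ 2 +
      Real.sqrt (2 * ε / γ) * ‖xp - x‖ + ε := by
  have hdescent := le_quadratic_of_lipschitz_gradient hg hlip x xp
  have hprox := le_sqrt_mul_add_of_forall_le hγ0 hε (norm_nonneg (xp - x))
    (fun t ht0 ht1 => hstep.segment_le hconv hγ0 ht0 ht1)
  linarith
end
end

section
/- (KL recursion along the AIPG sequence.) Let h : ℝ^N → ℝ be convex, let g : ℝ^N → ℝ be differentiable with L-Lipschitz continuous gradient, let f = g + h be bounded below, let 0 < γ and α ≥ 0 satisfy 1/(2γ) − L/2 − α > 0, and let (x_k), (v_k) be sequences in ℝ^N with v_{k+1} ∈ Prox^{ε_k}_{γh}(x_k − γ∇g(x_k)), ε_k = α·‖v_{k+1} − x_k‖², and f(x_{k+1}) ≤ f(v_{k+1}) for all k, so that (f(v_k)) is nonincreasing with limit f* ∈ ℝ. Suppose there exist C > 0, θ ∈ (0, 1] and an index k₀ such that for all k > k₀ with f(v_k) > f*: C·(f(v_k) − f*)^{θ−1}·dist(0, ∇g(v_k)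 + ∂_{ε_{k−1}} h(v_k)) ≥ 1. Then, writing r_k = f(v_k) − f* and d₁ = (1/γ + L + √(2α/γ))² / (1/(2γ) − L/2 − α), for all k > k₀ + 1 with r_k > 0: 1 ≤ d₁·C²·r_k^{2θ−2}·( r_{k−1} − r_k ). -/
open scoped RealInnerProductSpace
open Filter Topology

noncomputable section

/-- Sandwich theorem: a continuous affine function separates a continuous concave function from
a convex function lying above it. -/
theorem exists_affine_between {F : Type*} [NormedAddCommGroup F] [NormedSpace ℝ F]
    {p h : F → ℝ} (hp : ConcaveOn ℝ Set.univ p) (hpc : Continuous p)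
    (hh : ConvexOn ℝ Set.univ h) (hle : ∀ x, p x ≤ h x) :
    ∃ (l : F →L[ℝ] ℝ) (c : ℝ), ∀ x, p x ≤ l x + c ∧ l x + c ≤ h x := by
  have hopen : IsOpen {q : F × ℝ | q.1 ∈ Set.univ ∧ q.2 < p q.1} := by
    simpa using isOpen_lt continuous_snd (hpc.comp continuous_fst)
  have hdisj : Disjoint {q : F × ℝ | q.1 ∈ Set.univ ∧ q.2 < p q.1}
      {q : F × ℝ | q.1 ∈ Set.univ ∧ h q.1 ≤ q.2} := by
    rw [Set.disjoint_left]
    rintro ⟨a, t⟩ ⟨-, h1⟩ ⟨-, h2⟩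
    exact absurd (h1.trans_le (hle a)) (not_lt.2 h2)
  obtain ⟨f, u, hs, ht⟩ := geometric_hahn_banach_open hp.convex_strict_hypograph hopen
    hh.convex_epigraph hdisj
  have hf : ∀ (x : F) (t : ℝ), f (x, t) = f (x, 0) + t * f (0, 1) := by
    intro x t
    have : ((x, t) : F × ℝ) = (x, 0) + t • (0, 1) := by simp
    rw [this, map_add, map_smul, smul_eq_mul]
  have hlow : ∀ x t, t < p x → f (x, 0) + t * f (0, 1) < u := fun x t hxt => by
    rw [← hf]; exact hs (x, t) ⟨trivial, hxt⟩
  have hup : ∀ x, u ≤ f (x, 0) + h x * f (0, 1) := fun x => by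
    rw [← hf]; exact ht (x, h x) ⟨trivial, le_rfl⟩
  have hpos : 0 < f (0, 1) := by
    have h1 := hlow 0 (p 0 - 1) (by linarith)
    have h2 := hup 0
    have h3 := hle 0
    by_contra! hneg
    nlinarith
  refine ⟨-(f (0, 1))⁻¹ • f.comp (ContinuousLinearMap.inl ℝ F ℝ), (f (0, 1))⁻¹ * u, fun x => ?_⟩
  have heval : (-(f (0, 1))⁻¹ • f.comp (ContinuousLinearMap.inl ℝ F ℝ)) x + (f (0, 1))⁻¹ * u
      = (u - f (x, 0)) / f (0, 1) := by
    simp only [smul_apply, ContinuousLinearMap.comp_apply,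
      ContinuousLinearMap.inl_apply, smul_eq_mul]
    ring
  rw [heval]
  constructor
  · refine le_of_forall_lt fun t hxt => ?_
    rw [lt_div_iff₀ hpos]
    linarith [hlow x t hxt]
  · rw [div_le_iff₀ hpos]
    linarith [hup x]

/-- Descent lemma for a function with Lipschitz gradient. -/
theorem le_add_inner_add_sq_of_lipschitz_gradient {F : Type*} [NormedAddCommGroup F]
    [InnerProductSpace ℝ F] [CompleteSpace F] {g : F → ℝ} {g' : F → F} {L : ℝ}
    (hg : ∀ x, HasGradientAt g (g' x) x) (hlip : ∀ x y, ‖g' x - g' y‖ ≤ L * ‖x - y‖) (u z : F) :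
    g z ≤ g u + ⟪g' u, z - u⟫ + L / 2 * ‖z - u‖ ^ 2 := by
  set s := z - u with hs
  have hderiv : ∀ t : ℝ, HasDerivAt
      (fun t : ℝ => g (u + t • s) - t * ⟪g' u, s⟫ - L / 2 * ‖s‖ ^ 2 * t ^ 2)
      (⟪g' (u + t • s), s⟫ - ⟪g' u, s⟫ - L / 2 * ‖s‖ ^ 2 * (2 * t)) t := by
    intro t
    have hline : HasDerivAt (fun t : ℝ => u + t • s) s t := by
      simpa using ((hasDerivAt_id t).smul_const s).const_add u
    have h1 : HasDerivAt (fun t : ℝ => g (u + t • s)) ⟪g' (u + t • s), s⟫ t := by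
      simpa [Function.comp_def] using (hg (u + t • s)).hasFDerivAt.comp_hasDerivAt t hline
    have h2 : HasDerivAt (fun t : ℝ => t * ⟪g' u, s⟫) ⟪g' u, s⟫ t := by
      simpa using (hasDerivAt_id t).mul_const ⟪g' u, s⟫
    have h3 : HasDerivAt (fun t : ℝ => L / 2 * ‖s‖ ^ 2 * t ^ 2) (L / 2 * ‖s‖ ^ 2 * (2 * t)) t := by
      simpa using (hasDerivAt_pow 2 t).const_mul (L / 2 * ‖s‖ ^ 2)
    exact (h1.sub h2).sub h3
  have hanti : AntitoneOn
      (fun t : ℝ => g (u + t • s) - t * ⟪g' u, s⟫ - L / 2 * ‖s‖ ^ 2 * t ^ 2) (Set.Icc 0 1) := by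
    refine antitoneOn_of_deriv_nonpos (convex_Icc 0 1)
      (fun t _ => (hderiv t).continuousAt.continuousWithinAt)
      (fun t _ => (hderiv t).differentiableAt.differentiableWithinAt) fun t ht => ?_
    rw [interior_Icc] at ht
    rw [(hderiv t).deriv, ← inner_sub_left]
    have h1 := real_inner_le_norm (g' (u + t • s) - g' u) s
    have h2 := hlip (u + t • s) u
    rw [add_sub_cancel_left, norm_smul, Real.norm_of_nonneg ht.1.le] at h2
    nlinarith [mul_le_mul_of_nonneg_right h2 (norm_nonneg s)]
  have h01 := hanti (Set.left_mem_Icc.2 zero_le_one) (Set.right_mem_Icc.2 zero_le_one) zero_le_one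
  simp only [one_smul, zero_smul, add_zero, hs, add_sub_cancel] at h01
  simp only [hs]
  linarith

/-- An inexact proximal point `z` at `y` satisfies `(y - z + r) / γ ∈ ∂_ε h(z)` for some `r` with
`‖r‖² ≤ 2γε`. -/
theorem IsInexactProx.exists_mem_epsSubdiff {N : ℕ} {γ ε : ℝ} {h : E N → ℝ} {y z : E N}
    (hz : IsInexactProx γ h ε y z) (hγ : 0 < γ) (hconv : ConvexOn ℝ Set.univ h) :
    ∃ r : E N, ‖r‖ ^ 2 ≤ 2 * γ * ε ∧ γ⁻¹ • (y - z + r) ∈ epsSubdiff h ε z := by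
  have hq : ConvexOn ℝ Set.univ fun w : E N => 1 / (2 * γ) * ‖w - y‖ ^ 2 := by
    have h1 := ((convexOn_univ_dist (E := E N) y).pow (fun _ _ => dist_nonneg) 2).smul
      (show (0 : ℝ) ≤ 1 / (2 * γ) by positivity)
    simpa [dist_eq_norm] using h1
  have hp : ConcaveOn ℝ Set.univ fun w : E N =>
      -(1 / (2 * γ) * ‖w - y‖ ^ 2) + (1 / (2 * γ) * ‖z - y‖ ^ 2 + h z - ε) :=
    hq.neg.add_const _
  obtain ⟨l, c, hl⟩ := exists_affine_between hp (by fun_prop) hconv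
    (fun w => by linarith [hz w])
  set d := (InnerProductSpace.toDual ℝ (E N)).symm l with hd
  have hdl : ∀ w, l w = ⟪d, w⟫ := fun w => by simp [hd]
  have hlz := hl z
  refine ⟨γ • d + (z - y), ?_, ?_⟩
  · set r := γ • d + (z - y) with hr
    have h1 := (hl (z - r)).1
    have hzr : z - r - y = (z - y) - r := by abel
    rw [hzr, norm_sub_sq_real, map_sub] at h1
    have hlr : γ * l r = ‖r‖ ^ 2 - ⟪z - y, r⟫ := by
      have : γ • d = r - (z - y) := by rw [hr]; abel
      rw [hdl, ← real_inner_smul_left, this, inner_sub_left, real_inner_self_eq_norm_sq]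
    have h2 : 1 / (2 * γ) * (2 * ⟪z - y, r⟫ - ‖r‖ ^ 2) ≤ ε - l r := by linarith [hlz.2]
    have h3 := mul_le_mul_of_nonneg_left h2 (show 0 ≤ 2 * γ by positivity)
    rw [← mul_assoc, mul_one_div_cancel (by positivity), one_mul] at h3
    linarith
  · have : γ⁻¹ • (y - z + (γ • d + (z - y))) = d := by
      have : y - z + (γ • d + (z - y)) = γ • d := by abel
      rw [this, inv_smul_smul₀ hγ.ne']
    rw [this]
    intro w
    rw [inner_sub_right, ← hdl, ← hdl]
    linarith [(hl w).2, hlz.1]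

/-- Sufficient decrease of an inexact proximal gradient step. -/
theorem IsInexactProx.sufficient_decrease {N : ℕ} {γ α L : ℝ} {g h : E N → ℝ} {g' : E N → E N}
    {u z : E N} (hz : IsInexactProx γ h (α * ‖z - u‖ ^ 2) (u - γ • g' u) z) (hγ : 0 < γ)
    (hg : ∀ x, HasGradientAt g (g' x) x) (hlip : ∀ x y, ‖g' x - g' y‖ ≤ L * ‖x - y‖) :
    (1 / (2 * γ) - L / 2 - α) * ‖z - u‖ ^ 2 ≤ (g u + h u) - (g z + h z) := by
  have h1 := hz u
  have h2 := le_add_inner_add_sq_of_lipschitz_gradient hg hlip u z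
  have hzu : z - (u - γ • g' u) = (z - u) + γ • g' u := by abel
  rw [hzu, sub_sub_cancel, norm_add_sq_real, real_inner_smul_right, real_inner_comm] at h1
  have h3 : 1 / (2 * γ) * (‖z - u‖ ^ 2 + 2 * (γ * ⟪g' u, z - u⟫) + ‖γ • g' u‖ ^ 2)
      = 1 / (2 * γ) * ‖z - u‖ ^ 2 + ⟪g' u, z - u⟫ + 1 / (2 * γ) * ‖γ • g' u‖ ^ 2 := by
    field_simp
  linarith

/-- Relative error bound of an inexact proximal gradient step. -/
theorem IsInexactProx.exists_norm_add_le {N : ℕ} {γ α L : ℝ} {h : E N → ℝ} {g' : E N → E N}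
    {u z : E N} (hz : IsInexactProx γ h (α * ‖z - u‖ ^ 2) (u - γ • g' u) z) (hγ : 0 < γ)
    (hα : 0 ≤ α) (hconv : ConvexOn ℝ Set.univ h)
    (hlip : ∀ x y, ‖g' x - g' y‖ ≤ L * ‖x - y‖) :
    ∃ d ∈ epsSubdiff h (α * ‖z - u‖ ^ 2) z,
      ‖g' z + d‖ ≤ (1 / γ + L + Real.sqrt (2 * α / γ)) * ‖z - u‖ := by
  obtain ⟨r, hr, hmem⟩ := hz.exists_mem_epsSubdiff hγ hconv
  refine ⟨_, hmem, ?_⟩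
  have hdecomp : g' z + γ⁻¹ • (u - γ • g' u - z + r) =
      (g' z - g' u) + γ⁻¹ • (u - z) + γ⁻¹ • r := by
    simp only [smul_add, smul_sub, inv_smul_smul₀ hγ.ne']
    abel
  have hrn : ‖γ⁻¹ • r‖ ≤ Real.sqrt (2 * α / γ) * ‖z - u‖ := by
    refine le_of_sq_le_sq ?_ (by positivity)
    rw [mul_pow, Real.sq_sqrt (by positivity), norm_smul, mul_pow, norm_inv,
      Real.norm_of_nonneg hγ.le]
    calc γ⁻¹ ^ 2 * ‖r‖ ^ 2 ≤ γ⁻¹ ^ 2 * (2 * γ * (α * ‖z - u‖ ^ 2)) := by gcongr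
      _ = 2 * α / γ * ‖z - u‖ ^ 2 := by field_simp
  have huz : ‖γ⁻¹ • (u - z)‖ = 1 / γ * ‖z - u‖ := by
    rw [norm_smul, norm_inv, Real.norm_of_nonneg hγ.le, norm_sub_rev, one_div]
  rw [hdecomp]
  linarith [norm_add₃_le (a := g' z - g' u) (b := γ⁻¹ • (u - z)) (c := γ⁻¹ • r), hlip z u]

/-- KL recursion along the AIPG sequence. -/
theorem aipg_kl_recursion {N : ℕ} (g h : E N → ℝ) (g' : E N → E N)
    (L γ α C θ fstar : ℝ) (hL : 0 < L)
    (hg : ∀ x, HasGradientAt g (g' x) x)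
    (hlip : ∀ x y, ‖g' x - g' y‖ ≤ L * ‖x - y‖)
    (hconv : ConvexOn ℝ Set.univ h)
    (hbdd : BddBelow (Set.range fun y => g y + h y))
    (hγ0 : 0 < γ) (hα : 0 ≤ α) (hcoef : 0 < 1 / (2 * γ) - L / 2 - α)
    (hC : 0 < C) (hθ0 : 0 < θ) (hθ1 : θ ≤ 1)
    (x v : ℕ → E N)
    (hstep : ∀ k, IsInexactProx γ h (α * ‖v (k + 1) - x k‖ ^ 2)
      (x k - γ • g' (x k)) (v (k + 1)))
    (hdesc : ∀ k, g (x (k + 1)) + h (x (k + 1)) ≤ g (v (k + 1)) + h (v (k + 1)))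
    (hvmono : ∀ k, g (v (k + 1)) + h (v (k + 1)) ≤ g (v k) + h (v k))
    (hlimv : Tendsto (fun k => g (v k) + h (v k)) atTop (𝓝 fstar))
    (hlimx : Tendsto (fun k => g (x k) + h (x k)) atTop (𝓝 fstar))
    (k₀ : ℕ)
    (hKL : ∀ k, k₀ < k → fstar < g (v k) + h (v k) →
      ∀ d ∈ epsSubdiff h (α * ‖v k - x (k - 1)‖ ^ 2) (v k),
        1 ≤ C * (g (v k) + h (v k) - fstar) ^ (θ - 1) * ‖g' (v k) + d‖) :
    ∀ k, k₀ + 1 < k → 0 < g (v k) + h (v k) - fstar →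
      1 ≤ (1 / γ + L + Real.sqrt (2 * α / γ)) ^ 2 / (1 / (2 * γ) - L / 2 - α) * C ^ 2 *
        (g (v k) + h (v k) - fstar) ^ (2 * θ - 2) *
        ((g (v (k - 1)) + h (v (k - 1))) - (g (v k) + h (v k))) := by
  intro k hk hrk
  obtain ⟨m, rfl⟩ : ∃ m, k = m + 1 + 1 := ⟨k - 2, by omega⟩
  simp only [Nat.add_sub_cancel] at hKL ⊢
  have hz := hstep (m + 1)
  obtain ⟨d, hd, hdn⟩ := hz.exists_norm_add_le hγ0 hα hconv hlip
  have hdec := hz.sufficient_decrease hγ0 hg hlip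
  have hkl := hKL (m + 1 + 1) (by omega) (by linarith) d hd
  set R := g (v (m + 1 + 1)) + h (v (m + 1 + 1)) - fstar
  set a := ‖v (m + 1 + 1) - x (m + 1)‖
  set K := 1 / γ + L + Real.sqrt (2 * α / γ)
  set D := 1 / (2 * γ) - L / 2 - α
  have hRpow : R ^ (2 * θ - 2) = (R ^ (θ - 1)) ^ 2 := by
    rw [← Real.rpow_natCast, ← Real.rpow_mul hrk.le]
    congr 1
    push_cast
    ring
  have hone : 1 ≤ C * R ^ (θ - 1) * (K * a) :=
    hkl.trans (mul_le_mul_of_nonneg_left hdn (by positivity))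
  have ha : a ^ 2 ≤ (g (v (m + 1)) + h (v (m + 1)) - (g (v (m + 1 + 1)) + h (v (m + 1 + 1)))) / D :=
    (le_div_iff₀ hcoef).2 (by linarith [hdesc m])
  calc (1 : ℝ) ≤ (C * R ^ (θ - 1) * (K * a)) ^ 2 := one_le_pow₀ hone
    _ = K ^ 2 * C ^ 2 * R ^ (2 * θ - 2) * a ^ 2 := by rw [hRpow]; ring
    _ ≤ K ^ 2 * C ^ 2 * R ^ (2 * θ - 2) *
        ((g (v (m + 1)) + h (v (m + 1)) - (g (v (m + 1 + 1)) + h (v (m + 1 + 1)))) / D) :=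
      mul_le_mul_of_nonneg_left ha (by positivity)
    _ = _ := by ring
end
end
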